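/- arXiv:1902.05768 — 7 statements merged into one kernel-verified Lean document; each statement's English description precedes it below -/
import Mathlib

section
/- Let X be a nontrivial normed vector space, A a bounded linear operator on X, F₀ a linear subspace of X, and β ∈ ℝ. Let (Tₙ)_{n≥0} and (Sₙ)_{n≥0} be bounded linear operators on X with T₀ = Id and T_{n+1} = Sₙ ∘ A for every n ≥ 0. Define, with values in [0, ∞], M_T := sup{ ‖Tₙ(u)‖ e^{−βn} / ‖u‖ : n ≥ 0, u ∈ F₀ \ {0} } and M_S := sup{ ‖Sₙ(v)‖ e^{−βn} / ‖v‖ : n ≥ 0, v ∈ A(F₀) \ {0} }. If F₀ ≠ {0}, then M_T ≤ max{ 1, e^{−β} ‖A‖ · M_S }. -/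
open scoped ENNReal

/-- The recursive estimate `M_T ≤ max{1, e^{−β}‖A‖ · M_S}` for the comparison
suprema of a cocycle restricted to a subspace `F₀`: here `T₀ = Id`,
`T_{n+1} = Sₙ ∘ A`, and the suprema (with values in `[0, ∞]`) are taken over
`n ≥ 0` and nonzero vectors of `F₀` (resp. of `A(F₀)`). -/
theorem stmt7 {X : Type*} [NormedAddCommGroup X] [NormedSpace ℝ X] [Nontrivial X]
    (A : X →L[ℝ] X) (F₀ : Submodule ℝ X) (β : ℝ)
    (T S : ℕ → X →L[ℝ] X)
    (hT0 : T 0 = ContinuousLinearMap.id ℝ X)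
    (hTrec : ∀ n : ℕ, T (n + 1) = (S n).comp A)
    (hF₀ : F₀ ≠ ⊥) :
    (⨆ (n : ℕ) (u : {u : X // u ∈ F₀ ∧ u ≠ 0}),
        ENNReal.ofReal (‖T n u.1‖ * Real.exp (-β * n) / ‖u.1‖)) ≤
      max 1 (ENNReal.ofReal (Real.exp (-β) * ‖A‖) *
        ⨆ (n : ℕ) (v : {v : X // v ∈ F₀.map (A : X →ₗ[ℝ] X) ∧ v ≠ 0}),
          ENNReal.ofReal (‖S n v.1‖ * Real.exp (-β * n) / ‖v.1‖)) := by
  refine iSup₂_le fun n u => ?_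
  obtain ⟨u, hu, hu0⟩ := u
  have hun : 0 < ‖u‖ := norm_pos_iff.mpr hu0
  cases n with
  | zero => simp [hT0, hun.ne']
  | succ n =>
    refine le_max_of_le_right ?_
    by_cases hAu : A u = 0
    · simp [hTrec, hAu]
    have hAn : 0 < ‖A u‖ := norm_pos_iff.mpr hAu
    have key : ‖T (n + 1) u‖ * Real.exp (-β * (n + 1 : ℕ)) / ‖u‖ ≤
        Real.exp (-β) * ‖A‖ * (‖S n (A u)‖ * Real.exp (-β * n) / ‖A u‖) := by
      have hexp : Real.exp (-β * (n + 1 : ℕ)) = Real.exp (-β) * Real.exp (-β * n) := by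
        rw [← Real.exp_add]
        push_cast
        ring_nf
      calc ‖T (n + 1) u‖ * Real.exp (-β * (n + 1 : ℕ)) / ‖u‖
          = Real.exp (-β) * (‖A u‖ / ‖u‖) *
              (‖S n (A u)‖ * Real.exp (-β * n) / ‖A u‖) := by
            rw [hexp, hTrec, ContinuousLinearMap.comp_apply]
            field_simp
        _ ≤ _ := by
            gcongr
            exact A.ratio_le_opNorm u
    calc ENNReal.ofReal (‖T (n + 1) u‖ * Real.exp (-β * (n + 1 : ℕ)) / ‖u‖)
        ≤ ENNReal.ofReal (Real.exp (-β) * ‖A‖) *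
            ENNReal.ofReal (‖S n (A u)‖ * Real.exp (-β * n) / ‖A u‖) := by
          rw [← ENNReal.ofReal_mul (by positivity)]
          exact ENNReal.ofReal_le_ofReal key
      _ ≤ _ := by
          gcongr
          exact le_iSup₂_of_le n ⟨A u, Submodule.mem_map_of_mem hu, hAu⟩ le_rfl
end

section
/- Let X be a real normed vector space with two direct sum decompositions X = H ⊕ F and X = H′ ⊕ F′, and write π_{H′}, π_{F′} for the projections associated with the second decomposition; assume ‖π_{H′}(w)‖ ≤ ‖w‖ and ‖π_{F′}(w)‖ ≤ ‖w‖ for all w ∈ X. Let B, B′ be bounded linear operators on X and α, β, δ, θ ≥ 0 real numbers with: B(H) ⊆ H′; B(F) ⊆ F′; ‖B(h)‖ ≥ α‖h‖ for all h ∈ H; ‖B(v)‖ ≤ β‖v‖ for all v ∈ F; and ‖B′ − B‖ ≤ δ. Then for every u ∈ X, written u = u_H + u_F with u_H ∈ H, u_F ∈ F, satisfying the cone condition ‖u_F‖ ≤ θ‖u_H‖, one has ‖π_{H′}(B′u)‖ ≥ (α − (1+θ)δ)‖u_H‖ and ‖π_{F′}(B′u)‖ ≤ (βθ + (1+θ)δ)‖u_H‖.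 -/
/-- Components along two disjoint submodules are uniquely determined by their sum. -/
theorem Disjoint.eq_and_eq_of_add_eq_add {R M : Type*} [Ring R] [AddCommGroup M] [Module R M]
    {p q : Submodule R M} (hpq : Disjoint p q) {a a' b b' : M} (ha : a ∈ p) (ha' : a' ∈ p)
    (hb : b ∈ q) (hb' : b' ∈ q) (h : a + b = a' + b') : a = a' ∧ b = b' := by
  have hsub : a - a' = b' - b := by
    rw [sub_eq_sub_iff_add_eq_add, h, add_comm]
  have haa : a = a' := sub_eq_zero.mp <|
    Submodule.disjoint_def.mp hpq _ (p.sub_mem ha ha') (hsub ▸ q.sub_mem hb' hb)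
  exact ⟨haa, add_left_cancel (haa ▸ h)⟩

/-- One-step cone-invariance estimate: given splittings `X = H ⊕ F` and
`X = H' ⊕ F'` with the projections `π_{H'}, π_{F'}` of the second splitting of
norm at most `1`, a block operator `B` adapted to the splittings with expansion
`≥ α` on `H` and contraction `≤ β` on `F`, and a perturbation `B'` with
`‖B' − B‖ ≤ δ`, every vector `u = u_H + u_F` in the cone `‖u_F‖ ≤ θ‖u_H‖`
satisfies `‖π_{H'}(B'u)‖ ≥ (α − (1+θ)δ)‖u_H‖` and
`‖π_{F'}(B'u)‖ ≤ (βθ + (1+θ)δ)‖u_H‖`. -/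
theorem stmt8 {X : Type*} [NormedAddCommGroup X] [NormedSpace ℝ X]
    (H F H' F' : Submodule ℝ X) (hHF : IsCompl H F) (hH'F' : IsCompl H' F')
    (πH' πF' : X →ₗ[ℝ] X)
    (hπH'mem : ∀ w : X, πH' w ∈ H') (hπF'mem : ∀ w : X, πF' w ∈ F')
    (hsum : ∀ w : X, πH' w + πF' w = w)
    (hπH'norm : ∀ w : X, ‖πH' w‖ ≤ ‖w‖) (hπF'norm : ∀ w : X, ‖πF' w‖ ≤ ‖w‖)
    (B B' : X →L[ℝ] X) (α β δ θ : ℝ)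
    (hα : 0 ≤ α) (hβ : 0 ≤ β) (hδ : 0 ≤ δ) (hθ : 0 ≤ θ)
    (hBH : ∀ h ∈ H, B h ∈ H') (hBF : ∀ v ∈ F, B v ∈ F')
    (hBlow : ∀ h ∈ H, α * ‖h‖ ≤ ‖B h‖)
    (hBup : ∀ v ∈ F, ‖B v‖ ≤ β * ‖v‖)
    (hdiff : ‖B' - B‖ ≤ δ) :
    ∀ uH ∈ H, ∀ uF ∈ F, ‖uF‖ ≤ θ * ‖uH‖ →
      (α - (1 + θ) * δ) * ‖uH‖ ≤ ‖πH' (B' (uH + uF))‖ ∧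
      ‖πF' (B' (uH + uF))‖ ≤ (β * θ + (1 + θ) * δ) * ‖uH‖ := by
  intro uH huH uF huF hcone
  obtain ⟨hπH, hπF⟩ := hH'F'.disjoint.eq_and_eq_of_add_eq_add
    (hπH'mem _) (hBH uH huH) (hπF'mem _) (hBF uF huF) (hsum (B uH + B uF))
  set d : X := (B' - B) (uH + uF) with hd
  have hB' : B' (uH + uF) = (B uH + B uF) + d := by
    simp only [hd, sub_apply, map_add]
    abel
  have hu : ‖uH + uF‖ ≤ (1 + θ) * ‖uH‖ := by
    linarith [norm_add_le uH uF]
  have hdnorm : ‖d‖ ≤ δ * ((1 + θ) * ‖uH‖) :=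
    (B' - B).le_of_opNorm_le_of_le hdiff hu
  rw [hB', map_add πH' (B uH + B uF), map_add πF' (B uH + B uF), hπH, hπF]
  constructor
  · linarith [hBlow uH huH, hπH'norm d, norm_sub_le_norm_add (B uH) (πH' d)]
  · linarith [hBup uF huF, hπF'norm d, norm_add_le (B uF) (πF' d),
      mul_le_mul_of_nonneg_left hcone hβ]
end

section
/- Let X be a real normed vector space with two direct sum decompositions X = H ⊕ F and X = H′ ⊕ F′, whose four associated projections all have norm at most 1 (i.e. ‖u_H‖ ≤ ‖u‖ and ‖u_F‖ ≤ ‖u‖ for u = u_H + u_F, and likewise for the second splitting). Let B, B′ be bounded linear operators on X and α, β, γ, δ, θ ≥ 0 with: B(H) ⊆ H′; B(F) ⊆ F′; α‖h‖ ≤ ‖B(h)‖ ≤ γ‖h‖ for all h ∈ H; ‖B(v)‖ ≤ β‖v‖ for all v ∈ F; ‖B′ − B‖ ≤ δ. Then for every u = u_H + u_F with ‖u_F‖ ≤ θ‖u_H‖ one has (1+θ)^{−1}(α − (1+θ)δ)‖u‖ ≤ ‖B′(u)‖ ≤ (γ + βθ + (1+θ)δ)‖u‖. -/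
/-- Growth estimate for vectors in a cone under a perturbed block operator: given
splittings `X = H ⊕ F` and `X = H' ⊕ F'` whose four associated projections all
have norm at most `1`, a block operator `B` with `α‖h‖ ≤ ‖Bh‖ ≤ γ‖h‖` on `H` and
`‖Bv‖ ≤ β‖v‖` on `F`, and `‖B' − B‖ ≤ δ`, every `u = u_H + u_F` with
`‖u_F‖ ≤ θ‖u_H‖` satisfies
`(1+θ)⁻¹(α − (1+θ)δ)‖u‖ ≤ ‖B'(u)‖ ≤ (γ + βθ + (1+θ)δ)‖u‖`. -/
theorem stmt9 {X : Type*} [NormedAddCommGroup X] [NormedSpace ℝ X]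
    (H F H' F' : Submodule ℝ X) (hHF : IsCompl H F) (hH'F' : IsCompl H' F')
    (hproj : ∀ uH ∈ H, ∀ uF ∈ F, ‖uH‖ ≤ ‖uH + uF‖ ∧ ‖uF‖ ≤ ‖uH + uF‖)
    (hproj' : ∀ uH' ∈ H', ∀ uF' ∈ F', ‖uH'‖ ≤ ‖uH' + uF'‖ ∧ ‖uF'‖ ≤ ‖uH' + uF'‖)
    (B B' : X →L[ℝ] X) (α β γ δ θ : ℝ)
    (hα : 0 ≤ α) (hβ : 0 ≤ β) (hγ : 0 ≤ γ) (hδ : 0 ≤ δ) (hθ : 0 ≤ θ)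
    (hBH : ∀ h ∈ H, B h ∈ H') (hBF : ∀ v ∈ F, B v ∈ F')
    (hBlow : ∀ h ∈ H, α * ‖h‖ ≤ ‖B h‖)
    (hBup : ∀ h ∈ H, ‖B h‖ ≤ γ * ‖h‖)
    (hBF' : ∀ v ∈ F, ‖B v‖ ≤ β * ‖v‖)
    (hdiff : ‖B' - B‖ ≤ δ) :
    ∀ uH ∈ H, ∀ uF ∈ F, ‖uF‖ ≤ θ * ‖uH‖ →
      (1 + θ)⁻¹ * (α - (1 + θ) * δ) * ‖uH + uF‖ ≤ ‖B' (uH + uF)‖ ∧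
      ‖B' (uH + uF)‖ ≤ (γ + β * θ + (1 + θ) * δ) * ‖uH + uF‖ := by
  intro uH hH uF hF hcone
  set u := uH + uF with hu
  have huH : ‖uH‖ ≤ ‖u‖ := (hproj uH hH uF hF).1
  have hu_le : ‖u‖ ≤ (1 + θ) * ‖uH‖ := by
    linarith [norm_add_le uH uF]
  have hBu : B u = B uH + B uF := map_add B uH uF
  have hpert : ‖B' u - B u‖ ≤ δ * ‖u‖ := (B' - B).le_of_opNorm_le hdiff u
  constructor
  · have hBu_ge : α * ‖uH‖ ≤ ‖B u‖ := by
      rw [hBu]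
      exact (hBlow uH hH).trans (hproj' _ (hBH uH hH) _ (hBF uF hF)).1
    have hB'u : ‖B u‖ - δ * ‖u‖ ≤ ‖B' u‖ := by
      linarith [norm_sub_norm_le (B u) (B' u), norm_sub_rev (B u) (B' u)]
    rw [mul_assoc, inv_mul_le_iff₀ (by positivity)]
    calc (α - (1 + θ) * δ) * ‖u‖ = α * ‖u‖ - (1 + θ) * (δ * ‖u‖) := by ring
      _ ≤ α * ((1 + θ) * ‖uH‖) - (1 + θ) * (δ * ‖u‖) := by gcongr
      _ = (1 + θ) * (α * ‖uH‖ - δ * ‖u‖) := by ring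
      _ ≤ (1 + θ) * ‖B' u‖ := by gcongr; linarith
  · calc ‖B' u‖ ≤ ‖B u‖ + ‖B' u - B u‖ := norm_le_insert' _ _
      _ ≤ ‖B uH‖ + ‖B uF‖ + ‖B' u - B u‖ := by rw [hBu]; gcongr; exact norm_add_le _ _
      _ ≤ γ * ‖uH‖ + β * (θ * ‖uH‖) + δ * ‖u‖ := by
        gcongr
        · exact hBup uH hH
        · exact (hBF' uF hF).trans (by gcongr)
      _ ≤ γ * ‖u‖ + β * (θ * ‖u‖) + (1 + θ) * (δ * ‖u‖) := by
        have hδu : δ * ‖u‖ ≤ (1 + θ) * (δ * ‖u‖) :=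
          le_mul_of_one_le_left (by positivity) (by linarith)
        refine add_le_add ?_ hδu
        gcongr
      _ = (γ + β * θ + (1 + θ) * δ) * ‖u‖ := by ring
end

section
/- Let χ : ℕ → {0, 1}, let a, τ, ε be real numbers with 0 ≤ τ ≤ a and ε > 0, and let n be a positive integer. Assume that (a − τ)m ≤ ∑_{j=0}^{m−1} χ(j) ≤ (a + τ)m for every integer m ≥ n, and that n(aε − 2τ − τε) ≥ 1. Then there exists an integer k with n ≤ k ≤ n(1 + ε) and χ(k) = 1. -/
/-- Counting argument for return times: if `χ : ℕ → {0,1}`, `0 ≤ τ ≤ a`, `ε > 0`,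
`n` is a positive integer, the Birkhoff sums satisfy
`(a − τ)m ≤ ∑_{j<m} χ(j) ≤ (a + τ)m` for every integer `m ≥ n`, and
`n(aε − 2τ − τε) ≥ 1`, then there is an integer `k ∈ [n, n(1+ε)]` with `χ(k) = 1`. -/
theorem stmt11 (χ : ℕ → ℝ) (hχ : ∀ j, χ j = 0 ∨ χ j = 1)
    (a τ ε : ℝ) (hτ : 0 ≤ τ) (hτa : τ ≤ a) (hε : 0 < ε)
    (n : ℕ) (hn : 0 < n)
    (hfreq : ∀ m : ℕ, n ≤ m →
      (a - τ) * m ≤ ∑ j ∈ Finset.range m, χ j ∧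
        ∑ j ∈ Finset.range m, χ j ≤ (a + τ) * m)
    (hbig : 1 ≤ (n : ℝ) * (a * ε - 2 * τ - τ * ε)) :
    ∃ k : ℕ, n ≤ k ∧ (k : ℝ) ≤ n * (1 + ε) ∧ χ k = 1 := by
  by_contra! h
  have hpos : (0 : ℝ) ≤ n * (1 + ε) := by positivity
  set m := ⌊(n : ℝ) * (1 + ε)⌋₊ + 1 with hm
  have hlt : (n : ℝ) * (1 + ε) < m := by
    rw [hm]
    exact_mod_cast Nat.lt_floor_add_one ((n : ℝ) * (1 + ε))
  have hnm : n ≤ m := by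
    have : (n : ℝ) ≤ m := by nlinarith [(Nat.cast_nonneg n : (0 : ℝ) ≤ n)]
    exact_mod_cast this
  have hsum : ∑ j ∈ Finset.range n, χ j = ∑ j ∈ Finset.range m, χ j := by
    refine Finset.sum_subset (Finset.range_subset_range.2 hnm) fun j hj hjn => ?_
    rw [Finset.mem_range] at hj hjn
    exact (hχ j).resolve_right
      (h j (not_lt.1 hjn) ((Nat.le_floor_iff hpos).1 (Nat.lt_succ_iff.1 hj)))
  have hlower := (hfreq m hnm).1
  have hupper := (hfreq n le_rfl).2
  have hmul := mul_le_mul_of_nonneg_left hlt.le (sub_nonneg.2 hτa)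
  linarith
end

section
/- Let (M, ℬ, μ) be a probability space, f : M → M a measurable, μ-preserving, ergodic transformation, P ∈ ℬ with μ(P) > 0, and ε > 0. For n ≥ 1 define Aₙ := { x ∈ P : there exists an integer k with n ≤ k ≤ n(1+ε) and f^k(x) ∈ P }. Then μ(Aₙ) → μ(P) as n → ∞. -/
open Filter MeasureTheory
open scoped Topology

/-- Almost every point of an ergodic system visits a given set of positive measure. -/
theorem Ergodic.measure_iInter_preimage_compl_eq_zero {M : Type*} [MeasurableSpace M]
    {μ : Measure M} [IsFiniteMeasure μ] {f : M → M} (hf : Ergodic f μ)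
    {P : Set M} (hP : MeasurableSet P) (hPpos : 0 < μ P) :
    μ (⋂ k : ℕ, f^[k] ⁻¹' Pᶜ) = 0 := by
  have hmeas : MeasurableSet (⋃ k : ℕ, f^[k] ⁻¹' P) :=
    MeasurableSet.iUnion fun k => (hf.measurable.iterate k) hP
  have hsub : f ⁻¹' (⋃ k : ℕ, f^[k] ⁻¹' P) ⊆ ⋃ k : ℕ, f^[k] ⁻¹' P := by
    intro x hx
    obtain ⟨k, hk⟩ := Set.mem_iUnion.1 hx
    exact Set.mem_iUnion.2 ⟨k + 1, hk⟩
  rcases hf.ae_empty_or_univ_of_preimage_ae_le hmeas.nullMeasurableSet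
    hsub.eventuallyLE with h | h
  · have hzero := measure_mono_null (Set.subset_iUnion (fun k : ℕ => f^[k] ⁻¹' P) 0)
      (ae_eq_empty.1 h)
    exact absurd hzero hPpos.ne'
  · have hcompl := ae_eq_univ.1 h
    rwa [Set.compl_iUnion] at hcompl

/-- The measure of the set of points that do not visit `P` at any of the times `0, …, m` tends to
zero as `m → ∞`. -/
theorem Ergodic.tendsto_measure_iInter_preimage_compl {M : Type*} [MeasurableSpace M]
    {μ : Measure M} [IsFiniteMeasure μ] {f : M → M} (hf : Ergodic f μ)
    {P : Set M} (hP : MeasurableSet P) (hPpos : 0 < μ P) :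
    Tendsto (fun m : ℕ => μ (⋂ k ≤ m, f^[k] ⁻¹' Pᶜ)) atTop (𝓝 0) := by
  have h := tendsto_measure_iInter_le (μ := μ) (f := fun k : ℕ => f^[k] ⁻¹' Pᶜ)
    (fun k => ((hf.measurable.iterate k) hP.compl).nullMeasurableSet)
    ⟨0, measure_ne_top _ _⟩
  rwa [hf.measure_iInter_preimage_compl_eq_zero hP hPpos] at h

/-- Return times in the window `[n, n(1+ε)]`: if `f` is an ergodic
measure-preserving transformation of a probability space, `P` is measurable with
`μ(P) > 0` and `ε > 0`, then the measure of
`Aₙ = {x ∈ P : ∃ k ∈ [n, n(1+ε)], f^k(x) ∈ P}` tends to `μ(P)` as `n → ∞`. -/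
theorem stmt12 {M : Type*} [MeasurableSpace M]
    (μ : Measure M) [IsProbabilityMeasure μ]
    (f : M → M) (hf : Ergodic f μ)
    (P : Set M) (hP : MeasurableSet P) (hPpos : 0 < μ P) (ε : ℝ) (hε : 0 < ε) :
    Tendsto
      (fun n : ℕ =>
        μ {x | x ∈ P ∧ ∃ k : ℕ, n ≤ k ∧ (k : ℝ) ≤ n * (1 + ε) ∧ f^[k] x ∈ P})
      atTop (𝓝 (μ P)) := by
  have hfloor : Tendsto (fun n : ℕ => ⌊(n : ℝ) * ε⌋₊) atTop atTop :=
    tendsto_nat_floor_atTop.comp (tendsto_natCast_atTop_atTop.atTop_mul_const hε)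
  have hlim := (hf.tendsto_measure_iInter_preimage_compl hP hPpos).comp hfloor
  have hlower := ENNReal.Tendsto.sub (tendsto_const_nhds (x := μ P) (f := atTop)) hlim
    (Or.inl (measure_ne_top μ P))
  rw [tsub_zero] at hlower
  refine tendsto_of_tendsto_of_tendsto_of_le_of_le hlower tendsto_const_nhds
    (fun n => ?_) (fun n => measure_mono fun x hx => hx.1)
  have hmeas : MeasurableSet (⋂ k ≤ ⌊(n : ℝ) * ε⌋₊, f^[k] ⁻¹' Pᶜ) :=
    MeasurableSet.iInter fun k => MeasurableSet.iInter fun _ =>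
      (hf.measurable.iterate k) hP.compl
  simp only [Function.comp_apply]
  rw [tsub_le_iff_right, ← (hf.toMeasurePreserving.iterate n).measure_preimage
    hmeas.nullMeasurableSet]
  refine (measure_mono fun x hx => ?_).trans (measure_union_le _ _)
  by_cases hvisit : f^[n] x ∈ ⋂ k ≤ ⌊(n : ℝ) * ε⌋₊, f^[k] ⁻¹' Pᶜ
  · exact Or.inr hvisit
  · left
    simp only [Set.mem_iInter, Set.mem_preimage, Set.mem_compl_iff, not_forall, not_not] at hvisit
    obtain ⟨k, hk, hkP⟩ := hvisit
    refine ⟨hx, k + n, Nat.le_add_left n k, ?_, ?_⟩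
    · have hk' := (Nat.le_floor_iff (by positivity : (0 : ℝ) ≤ n * ε)).1 hk
      push_cast
      linarith
    · rwa [Function.iterate_add_apply]
end

section
/- Let (M, ℬ, μ) be a probability space, f : M → M a measurable, μ-preserving, ergodic transformation, Λ ∈ ℬ, {P₁, …, P_t} a finite measurable partition of Λ, ε > 0, and φ₁, …, φ_J μ-integrable functions on M. For n ≥ 1 define Λₙ := { x ∈ Λ : there exists an integer k with n ≤ k ≤ (1+ε)n and f^k(x) ∈ P(x), and |(1/m) ∑_{p=0}^{m−1} φ_j(f^p x) − ∫ φ_j dμ| ≤ ε/4 for every m ≥ n and every 1 ≤ j ≤ J }, where P(x) denotes the partition element containing x. Then μ(Λₙ) → μ(Λ) as n → ∞. -/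
open Filter MeasureTheory
open scoped Topology

/-- The running maximum `max_{0 ≤ k ≤ n} S_k g` of the Birkhoff sums of `g`, computed recursively. -/
noncomputable def birkhoffMax {α : Type*} (f : α → α) (g : α → ℝ) : ℕ → α → ℝ
  | 0, _ => 0
  | n + 1, x => max 0 (g x + birkhoffMax f g n (f x))

section birkhoffMax

variable {α : Type*} {f : α → α} {g : α → ℝ}

theorem birkhoffMax_nonneg (n : ℕ) (x : α) : 0 ≤ birkhoffMax f g n x := by
  cases n with
  | zero => exact le_rfl
  | succ n => exact le_max_left _ _

theorem birkhoffMax_le_succ (n : ℕ) (x : α) :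
    birkhoffMax f g n x ≤ birkhoffMax f g (n + 1) x := by
  induction n generalizing x with
  | zero => exact birkhoffMax_nonneg _ _
  | succ n ih => exact max_le_max le_rfl (by gcongr; exact ih _)

theorem monotone_birkhoffMax (x : α) : Monotone fun n ↦ birkhoffMax f g n x :=
  monotone_nat_of_le_succ fun n ↦ birkhoffMax_le_succ n x

theorem birkhoffSum_le_birkhoffMax (n : ℕ) (x : α) :
    birkhoffSum f g n x ≤ birkhoffMax f g n x := by
  induction n generalizing x with
  | zero => simp [birkhoffMax]
  | succ n ih =>
    rw [birkhoffSum_succ']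
    exact le_max_of_le_right (by gcongr; exact ih _)

theorem birkhoffMax_succ_sub (n : ℕ) (x : α) :
    birkhoffMax f g (n + 1) x - birkhoffMax f g n (f x) = max (-birkhoffMax f g n (f x)) (g x) := by
  rw [birkhoffMax, ← max_sub_sub_right, zero_sub, add_sub_cancel_right]

theorem bddAbove_range_birkhoffMax_apply (x : α) :
    BddAbove (Set.range fun n ↦ birkhoffMax f g n (f x)) ↔
      BddAbove (Set.range fun n ↦ birkhoffMax f g n x) := by
  simp only [bddAbove_def, Set.forall_mem_range]
  constructor
  · rintro ⟨C, hC⟩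
    refine ⟨|g x| + C, fun n ↦ (birkhoffMax_le_succ n x).trans (max_le ?_ ?_)⟩
    · exact add_nonneg (abs_nonneg _) ((birkhoffMax_nonneg 0 _).trans (hC 0))
    · exact add_le_add (le_abs_self _) (hC n)
  · rintro ⟨C, hC⟩
    refine ⟨C - g x, fun n ↦ ?_⟩
    have := (le_max_right 0 (g x + birkhoffMax f g n (f x))).trans (hC (n + 1))
    linarith

variable [MeasurableSpace α] {μ : Measure α}

theorem measurable_birkhoffMax (hf : Measurable f) (hg : Measurable g) (n : ℕ) :
    Measurable (birkhoffMax f g n) := by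
  induction n with
  | zero => exact measurable_const
  | succ n ih => exact measurable_const.max (hg.add (ih.comp hf))

theorem integrable_birkhoffMax (hf : MeasurePreserving f μ μ) (hg : Integrable g μ) (n : ℕ) :
    Integrable (birkhoffMax f g n) μ := by
  induction n with
  | zero => exact integrable_zero _ _ _
  | succ n ih =>
    exact (integrable_zero α ℝ μ).sup (hg.add (hf.integrable_comp_of_integrable ih))

/-- If the Birkhoff sums of an integrable function are almost everywhere unbounded above, then its
integral is nonnegative. -/
theorem integral_nonneg_of_not_bddAbove_birkhoffMax
    (hf : MeasurePreserving f μ μ) (hg : Integrable g μ)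
    (h : ∀ᵐ x ∂μ, ¬ BddAbove (Set.range fun n ↦ birkhoffMax f g n x)) : 0 ≤ ∫ x, g x ∂μ := by
  have hT := integrable_birkhoffMax hf hg
  have hTf n : Integrable (fun x ↦ birkhoffMax f g n (f x)) μ :=
    hf.integrable_comp_of_integrable (hT n)
  have hlim : Tendsto (fun n ↦ ∫ x, (birkhoffMax f g (n + 1) x - birkhoffMax f g n (f x)) ∂μ)
      atTop (𝓝 (∫ x, g x ∂μ)) := by
    refine tendsto_integral_of_dominated_convergence (fun x ↦ |g x|)
      (fun n ↦ ((hT _).sub (hTf n)).aestronglyMeasurable) hg.abs (fun n ↦ ?_) ?_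
    · refine Eventually.of_forall fun x ↦ ?_
      rw [birkhoffMax_succ_sub, Real.norm_eq_abs, abs_le]
      have := birkhoffMax_nonneg (f := f) (g := g) n (f x)
      exact ⟨(neg_abs_le _).trans (le_max_right _ _),
        max_le (by linarith [abs_nonneg (g x)]) (le_abs_self _)⟩
    · filter_upwards [h] with x hx
      have htop : Tendsto (fun n ↦ birkhoffMax f g n (f x)) atTop atTop :=
        tendsto_atTop_atTop_of_monotone' (monotone_birkhoffMax _)
          (mt (bddAbove_range_birkhoffMax_apply x).1 hx)
      refine tendsto_const_nhds.congr' ?_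
      filter_upwards [htop.eventually_ge_atTop (-g x)] with n hn
      rw [birkhoffMax_succ_sub, max_eq_right (by linarith)]
  refine ge_of_tendsto' hlim fun n ↦ ?_
  rw [integral_sub (hT _) (hTf n), sub_nonneg]
  have : ∫ x, birkhoffMax f g n (f x) ∂μ = ∫ x, birkhoffMax f g n x ∂μ := by
    conv_rhs => rw [← hf.map_eq]
    refine (integral_map hf.aemeasurable ?_).symm
    rw [hf.map_eq]
    exact (hT n).aestronglyMeasurable
  rw [this]
  exact integral_mono (hT n) (hT _) fun x ↦ birkhoffMax_le_succ n x

end birkhoffMax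

section Birkhoff

variable {α : Type*} [MeasurableSpace α] {μ : Measure α} {f : α → α} {g : α → ℝ}

theorem Ergodic.ae_bddAbove_birkhoffSum (hf : Ergodic f μ) (hg : Integrable g μ)
    (hneg : ∫ x, g x ∂μ < 0) :
    ∀ᵐ x ∂μ, BddAbove (Set.range fun n ↦ birkhoffSum f g n x) := by
  wlog hgm : Measurable g generalizing g
  · obtain ⟨g', hg'm, hgg'⟩ := hg.aestronglyMeasurable.aemeasurable
    have hsum : ∀ᵐ x ∂μ, ∀ n, birkhoffSum f g n x = birkhoffSum f g' n x :=
      ae_all_iff.2 fun n ↦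
        hf.toMeasurePreserving.quasiMeasurePreserving.birkhoffSum_ae_eq_of_ae_eq hgg' n
    filter_upwards [this (hg.congr hgg') (by rwa [← integral_congr_ae hgg']) hg'm, hsum]
      with x hx hsum
    simpa only [hsum] using hx
  have hmeas : MeasurableSet {x | BddAbove (Set.range fun n ↦ birkhoffMax f g n x)} :=
    measurableSet_bddAbove_range fun n ↦ measurable_birkhoffMax hf.measurable hgm n
  rcases hf.toPreErgodic.ae_mem_or_ae_notMem hmeas
    (Set.ext fun x ↦ bddAbove_range_birkhoffMax_apply x) with h | h
  · filter_upwards [h] with x hx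
    obtain ⟨C, hC⟩ := hx
    refine ⟨C, ?_⟩
    rintro _ ⟨n, rfl⟩
    exact (birkhoffSum_le_birkhoffMax n x).trans (hC ⟨n, rfl⟩)
  · exact absurd
      (integral_nonneg_of_not_bddAbove_birkhoffMax hf.toMeasurePreserving hg h) hneg.not_ge

theorem Ergodic.ae_eventually_birkhoffAverage_lt [IsProbabilityMeasure μ] (hf : Ergodic f μ)
    (hg : Integrable g μ) {c : ℝ} (hc : ∫ x, g x ∂μ < c) :
    ∀ᵐ x ∂μ, ∀ᶠ n in atTop, birkhoffAverage ℝ f g n x < c := by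
  obtain ⟨d, hd, hdc⟩ := exists_between hc
  have hint : ∫ x, (g x - d) ∂μ < 0 := by
    rw [integral_sub hg (integrable_const d)]
    simpa using hd
  filter_upwards [hf.ae_bddAbove_birkhoffSum (hg.sub (integrable_const d)) hint] with x hx
  obtain ⟨C, hC⟩ := hx
  have hlim : Tendsto (fun n : ℕ ↦ d + C / n) atTop (𝓝 (d + 0)) :=
    (tendsto_const_div_atTop_nhds_zero_nat C).const_add d
  rw [add_zero] at hlim
  filter_upwards [hlim.eventually_lt_const hdc, eventually_gt_atTop 0] with n hn hn0
  have hn0' : (0 : ℝ) < n := Nat.cast_pos.2 hn0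
  have hsum : birkhoffSum f g n x - n * d ≤ C := by
    simpa [birkhoffSum, Finset.sum_sub_distrib] using hC ⟨n, rfl⟩
  refine lt_of_le_of_lt ?_ hn
  rw [birkhoffAverage, smul_eq_mul, ← sub_le_iff_le_add', le_div_iff₀ hn0']
  have : ((n : ℝ)⁻¹ * birkhoffSum f g n x - d) * n = birkhoffSum f g n x - n * d := by
    field_simp
  rwa [this]

/-- **Birkhoff's pointwise ergodic theorem** for an ergodic map of a probability space. -/
theorem Ergodic.ae_tendsto_birkhoffAverage [IsProbabilityMeasure μ] (hf : Ergodic f μ)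
    (hg : Integrable g μ) :
    ∀ᵐ x ∂μ, Tendsto (fun n ↦ birkhoffAverage ℝ f g n x) atTop (𝓝 (∫ y, g y ∂μ)) := by
  obtain ⟨u, -, hu, hulim⟩ := exists_seq_strictAnti_tendsto (0 : ℝ)
  have hupper : ∀ᵐ x ∂μ, ∀ k, ∀ᶠ n in atTop,
      birkhoffAverage ℝ f g n x < ∫ y, g y ∂μ + u k :=
    ae_all_iff.2 fun k ↦ hf.ae_eventually_birkhoffAverage_lt hg (by linarith [hu k])
  have hlower : ∀ᵐ x ∂μ, ∀ k, ∀ᶠ n in atTop,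
      birkhoffAverage ℝ f (-g) n x < -∫ y, g y ∂μ + u k :=
    ae_all_iff.2 fun k ↦ hf.ae_eventually_birkhoffAverage_lt hg.neg (by
      simp only [Pi.neg_apply, integral_neg]; linarith [hu k])
  filter_upwards [hupper, hlower] with x hx hx'
  rw [Metric.tendsto_nhds]
  intro δ hδ
  obtain ⟨k, hk⟩ := (hulim.eventually_lt_const hδ).exists
  filter_upwards [hx k, hx' k] with n h1 h2
  simp only [birkhoffAverage_neg, Pi.neg_apply] at h2
  rw [Real.dist_eq, abs_lt]
  constructor <;> linarith

end Birkhoff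

/-- A point visiting `s` with positive asymptotic frequency visits `s` during `[n, (1 + ε) n]` for
all large `n`. -/
theorem eventually_exists_iterate_mem_of_tendsto_birkhoffAverage {α : Type*} {f : α → α}
    {s : Set α} {x : α} {a ε : ℝ} (ha : 0 < a) (hε : 0 < ε)
    (h : Tendsto (fun n ↦ birkhoffAverage ℝ f (s.indicator 1) n x) atTop (𝓝 a)) :
    ∀ᶠ n : ℕ in atTop, ∃ k : ℕ, n ≤ k ∧ (k : ℝ) ≤ (1 + ε) * n ∧ f^[k] x ∈ s := by
  set S : ℕ → ℝ := fun n ↦ birkhoffSum f (s.indicator 1) n x with hS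
  have hdiv : Tendsto (fun n : ℕ ↦ S n / n) atTop (𝓝 a) := by
    refine h.congr fun n ↦ ?_
    rw [birkhoffAverage, smul_eq_mul, div_eq_inv_mul]
  have hlow : a * (2 / (2 + ε)) < a := by
    rw [mul_div_assoc', div_lt_iff₀ (by positivity)]; nlinarith
  have hupp : a < a * ((2 + 2 * ε) / (2 + ε)) := by
    rw [mul_div_assoc', lt_div_iff₀ (by positivity)]; nlinarith
  obtain ⟨N, hN⟩ := eventually_atTop.1 (hdiv.eventually_const_lt hlow)
  filter_upwards [hdiv.eventually_lt_const hupp, eventually_ge_atTop N, eventually_gt_atTop 0]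
    with n hn hnN hn0
  by_contra! hcon
  have hn0' : (0 : ℝ) < n := Nat.cast_pos.2 hn0
  set m := ⌊(1 + ε) * n⌋₊ + 1 with hm
  have hmn : (1 + ε) * n < m := by
    rw [hm]; push_cast; exact Nat.lt_floor_add_one _
  have hnm : n ≤ m := by
    have : (n : ℝ) ≤ m := by nlinarith
    exact_mod_cast this
  have hSS : S m = S n := by
    refine (Finset.sum_subset (Finset.range_mono hnm) fun k hk hk' ↦ ?_).symm
    rw [Finset.mem_range] at hk hk'
    refine Set.indicator_of_notMem (hcon k (not_lt.1 hk') ?_) _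
    exact (Nat.le_floor_iff (by positivity)).1 (Nat.lt_succ_iff.1 hk)
  have h1 := hN m (hnN.trans hnm)
  rw [lt_div_iff₀ (by nlinarith), hSS] at h1
  rw [div_lt_iff₀ hn0'] at hn
  have h2 : a * (2 / (2 + ε)) * ((1 + ε) * n) ≤ a * (2 / (2 + ε)) * m := by gcongr
  have h3 : a * (2 / (2 + ε)) * ((1 + ε) * n) = a * ((2 + 2 * ε) / (2 + ε)) * n := by
    field_simp
  linarith

/-- If the sets `A n` are contained in `s` and almost every point of `s` eventually belongs to
`A n`, then `μ (A n) → μ s`. No measurability is needed. -/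
theorem MeasureTheory.tendsto_measure_of_ae_eventually_mem {α : Type*} [MeasurableSpace α]
    {μ : Measure α} {A : ℕ → Set α} {s : Set α} (hA : ∀ n, A n ⊆ s)
    (h : ∀ᵐ x ∂μ, x ∈ s → ∀ᶠ n in atTop, x ∈ A n) :
    Tendsto (fun n ↦ μ (A n)) atTop (𝓝 (μ s)) := by
  set B : ℕ → Set α := fun N ↦ ⋂ n ≥ N, A n with hB
  have hBmono : Monotone B := fun N N' hN ↦
    Set.iInter₂_mono' fun n hn ↦ ⟨n, hN.trans hn, subset_rfl⟩
  have hBA n : B n ⊆ A n := Set.iInter₂_subset n le_rfl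
  have hBs : μ (⋃ N, B N) = μ s := by
    refine le_antisymm (measure_mono (Set.iUnion_subset fun n ↦ (hBA n).trans (hA n)))
      (measure_mono_ae ?_)
    filter_upwards [h] with x hx hxs
    obtain ⟨N, hN⟩ := eventually_atTop.1 (hx hxs)
    exact Set.mem_iUnion.2 ⟨N, Set.mem_iInter₂.2 hN⟩
  exact tendsto_of_tendsto_of_tendsto_of_le_of_le (hBs ▸ tendsto_measure_iUnion_atTop hBmono)
    tendsto_const_nhds (fun n ↦ measure_mono (hBA n)) fun n ↦ measure_mono (hA n)

/-- Let `f` be an ergodic measure-preserving transformation of a probability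
space, `{P₁, …, P_t}` a finite measurable partition of a measurable set `Λ`,
`ε > 0` and `φ₁, …, φ_J` integrable functions. Let `Λₙ` be the set of `x ∈ Λ`
having a return time `k ∈ [n, (1+ε)n]` to their own partition element and whose
Birkhoff averages of every `φ_j` at all times `m ≥ n` are within `ε/4` of
`∫ φ_j dμ`. Then `μ(Λₙ) → μ(Λ)` as `n → ∞`. -/
theorem stmt13 {M : Type*} [MeasurableSpace M]
    (μ : Measure M) [IsProbabilityMeasure μ]
    (f : M → M) (hf : Ergodic f μ)
    (Λ : Set M) (hΛ : MeasurableSet Λ)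
    (t : ℕ) (P : Fin t → Set M) (hPmeas : ∀ i, MeasurableSet (P i))
    (hPdisj : ∀ i j, i ≠ j → Disjoint (P i) (P j))
    (hPunion : (⋃ i, P i) = Λ)
    (ε : ℝ) (hε : 0 < ε)
    (J : ℕ) (φ : Fin J → M → ℝ) (hφ : ∀ j, Integrable (φ j) μ) :
    Tendsto
      (fun n : ℕ =>
        μ {x | x ∈ Λ ∧
          (∃ k : ℕ, n ≤ k ∧ (k : ℝ) ≤ (1 + ε) * n ∧
            ∃ i : Fin t, x ∈ P i ∧ f^[k] x ∈ P i) ∧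
          ∀ m : ℕ, n ≤ m → ∀ j : Fin J,
            |(1 / (m : ℝ)) * ∑ p ∈ Finset.range m, φ j (f^[p] x) - ∫ y, φ j y ∂μ|
              ≤ ε / 4})
      atTop (𝓝 (μ Λ)) := by
  refine tendsto_measure_of_ae_eventually_mem (fun n x hx ↦ hx.1) ?_
  have hφlim : ∀ᵐ x ∂μ, ∀ j,
      Tendsto (fun n ↦ birkhoffAverage ℝ f (φ j) n x) atTop (𝓝 (∫ y, φ j y ∂μ)) :=
    ae_all_iff.2 fun j ↦ hf.ae_tendsto_birkhoffAverage (hφ j)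
  have hreturn : ∀ᵐ x ∂μ, ∀ i, x ∈ P i →
      ∀ᶠ n : ℕ in atTop, ∃ k : ℕ, n ≤ k ∧ (k : ℝ) ≤ (1 + ε) * n ∧ f^[k] x ∈ P i := by
    refine ae_all_iff.2 fun i ↦ ?_
    by_cases hPi : μ (P i) = 0
    · filter_upwards [measure_eq_zero_iff_ae_notMem.1 hPi] with x hx hxP
      exact absurd hxP hx
    · have hint : Integrable ((P i).indicator (1 : M → ℝ)) μ :=
        (integrable_const (1 : ℝ)).indicator (hPmeas i)
      filter_upwards [hf.ae_tendsto_birkhoffAverage hint] with x hx _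
      rw [integral_indicator_one (hPmeas i)] at hx
      exact eventually_exists_iterate_mem_of_tendsto_birkhoffAverage
        (ENNReal.toReal_pos hPi (measure_ne_top _ _)) hε hx
  filter_upwards [hφlim, hreturn] with x hxφ hxP hxΛ
  obtain ⟨i, hi⟩ := Set.mem_iUnion.1 (hPunion ▸ hxΛ)
  have havg : ∀ᶠ m : ℕ in atTop, ∀ j : Fin J,
      |(1 / (m : ℝ)) * ∑ p ∈ Finset.range m, φ j (f^[p] x) - ∫ y, φ j y ∂μ| ≤ ε / 4 := by
    refine eventually_all.2 fun j ↦ ?_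
    filter_upwards [Metric.tendsto_nhds.1 (hxφ j) (ε / 4) (by positivity)] with m hm
    rw [Real.dist_eq, birkhoffAverage, smul_eq_mul, birkhoffSum] at hm
    rw [one_div]
    exact hm.le
  filter_upwards [hxP i hi, eventually_forall_ge_atTop.2 havg] with n ⟨k, hnk, hkn, hk⟩ hn
  exact ⟨hxΛ, ⟨k, hnk, hkn, i, hi, hk⟩, hn⟩
end

section
/- Let X be a normed vector space, H, H′, G linear subspaces such that X = H′ ⊕ G (internal direct sum) and the projection π of X onto G along H′ is bounded with ‖π‖ ≤ c. Let T be a bounded linear operator on X and a > 0, b ≥ 0 with ‖T(u)‖ ≥ a‖u‖ for all u ∈ H and ‖T(w)‖ ≤ b‖w‖ for all w ∈ G. Then for every u ∈ H with u ≠ 0, inf{ ‖ T(u)/‖T(u)‖ − T(v) ‖ : v ∈ H′ } ≤ bc/a. -/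
/-- Contraction step for the Grassmannian Cauchy-sequence argument: if
`X = H' ⊕ G` with the projection `π` onto `G` along `H'` bounded by `c`, and `T`
expands `H` by at least `a > 0` and contracts `G` by at most `b`, then for every
nonzero `u ∈ H` the distance from `T(u)/‖T(u)‖` to `T(H')` is at most `bc/a`. -/
theorem stmt15 {X : Type*} [NormedAddCommGroup X] [NormedSpace ℝ X]
    (H H' G : Submodule ℝ X) (hcompl : IsCompl H' G)
    (π : X →ₗ[ℝ] X) (hπG : ∀ w : X, π w ∈ G) (hπH' : ∀ w : X, w - π w ∈ H')
    (c : ℝ) (hπnorm : ∀ w : X, ‖π w‖ ≤ c * ‖w‖)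
    (T : X →L[ℝ] X) (a b : ℝ) (ha : 0 < a) (hb : 0 ≤ b)
    (hTH : ∀ u ∈ H, a * ‖u‖ ≤ ‖T u‖)
    (hTG : ∀ w ∈ G, ‖T w‖ ≤ b * ‖w‖) :
    ∀ u ∈ H, u ≠ 0 →
      sInf {d : ℝ | ∃ v ∈ H', d = ‖(‖T u‖)⁻¹ • T u - T v‖} ≤ b * c / a := by
  intro u hu hu0
  have hu_pos : 0 < ‖u‖ := norm_pos_iff.mpr hu0
  have hTu_pos : 0 < ‖T u‖ := (mul_pos ha hu_pos).trans_le (hTH u hu)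
  have hc : 0 ≤ c := nonneg_of_mul_nonneg_left ((norm_nonneg _).trans (hπnorm u)) hu_pos
  have hbdd : BddBelow {d : ℝ | ∃ v ∈ H', d = ‖(‖T u‖)⁻¹ • T u - T v‖} :=
    ⟨0, by rintro _ ⟨v, -, rfl⟩; exact norm_nonneg _⟩
  refine (csInf_le hbdd ⟨(‖T u‖)⁻¹ • (u - π u), H'.smul_mem _ (hπH' u), rfl⟩).trans ?_
  have hdiff : (‖T u‖)⁻¹ • T u - T ((‖T u‖)⁻¹ • (u - π u)) = (‖T u‖)⁻¹ • T (π u) := by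
    rw [map_smul, map_sub, ← smul_sub, sub_sub_cancel]
  rw [hdiff, norm_smul, norm_inv, norm_norm, inv_mul_eq_div, div_le_div_iff₀ hTu_pos ha]
  calc ‖T (π u)‖ * a ≤ b * (c * ‖u‖) * a := by
        gcongr
        exact (hTG _ (hπG u)).trans (mul_le_mul_of_nonneg_left (hπnorm u) hb)
    _ = b * c * (a * ‖u‖) := by ring
    _ ≤ b * c * ‖T u‖ := mul_le_mul_of_nonneg_left (hTH u hu) (mul_nonneg hb hc)
end
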